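/- Let ι be a type and L a natural number, with ground set ι × Fin L. Let I be a finite index set, and for each k ∈ I let μ_k ≥ 0 and c_k > 0 be real constants, and for each k ∈ I, ℓ ∈ Fin L, e ∈ ι let M_{k,ℓ,e} be an n×n Hermitian positive semidefinite complex matrix. Define f : Finset (ι × Fin L) → ℝ by f(V) := Σ_{k∈I} μ_k · min( c_k · Σ_{ℓ=0}^{L−1} log((det(I_n + Σ_{e : (e,ℓ)∈V} M_{k,ℓ,e})).re), 1 ). Then f is a monotone submodular set function on the ground set ι × Fin L. -/

import Mathlib

open Matrix
open scoped ComplexOrder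

/-- A set function f : Finset ι → ℝ is submodular if
f(U ∪ {e}) − f(U) ≥ f(U' ∪ {e}) − f(U') for all U ⊆ U' and all e ∉ U'. -/
def Submodular {ι : Type*} [DecidableEq ι] (f : Finset ι → ℝ) : Prop :=
  ∀ U U' : Finset ι, U ⊆ U' → ∀ e ∉ U',
    f (insert e U) - f U ≥ f (insert e U') - f U'

/-- A set function f : Finset ι → ℝ is monotone if U ⊆ U' implies f(U) ≤ f(U'). -/
def MonotoneSetFn {ι : Type*} (f : Finset ι → ℝ) : Prop :=
  ∀ U U' : Finset ι, U ⊆ U' → f U ≤ f U'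

open MatrixOrder in
theorem aux_psd_fac {n : ℕ} {C : Matrix (Fin n) (Fin n) ℂ} (hC : C.PosSemidef) :
    ∃ X : Matrix (Fin n) (Fin n) ℂ, C = Xᴴ * X := by
  obtain ⟨X, hX⟩ := CStarAlgebra.nonneg_iff_eq_star_mul_self.mp (Matrix.nonneg_iff_posSemidef.mpr hC)
  exact ⟨X, hX⟩

theorem aux_one_le {n : ℕ} {S : Matrix (Fin n) (Fin n) ℂ} (hS : S.PosSemidef) :
    1 ≤ ((1 : Matrix (Fin n) (Fin n) ℂ) + S).det.re := by
  have h := hS.1.spectral_theorem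
  set U := hS.1.eigenvectorUnitary with hU
  have e1 : (1 : Matrix (Fin n) (Fin n) ℂ) + S =
      (U : Matrix (Fin n) (Fin n) ℂ) * (1 + diagonal (RCLike.ofReal ∘ hS.1.eigenvalues)) *
        (star U : Matrix (Fin n) (Fin n) ℂ) := by
    rw [mul_add, add_mul, mul_one]
    conv_lhs => rw [h]
    rw [Unitary.conjStarAlgAut_apply]
    simp
  have e2 : ((1 : Matrix (Fin n) (Fin n) ℂ) + S).det =
      ((∏ i, (1 + hS.1.eigenvalues i) : ℝ) : ℂ) := by
    rw [e1, det_mul_right_comm, (Unitary.mem_iff.mp U.2).2, one_mul, ← diagonal_one, diagonal_add,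
      det_diagonal]
    simp
  rw [e2, Complex.ofReal_re]
  have hp := Finset.prod_le_prod (s := Finset.univ) (f := fun _ : Fin n => (1 : ℝ))
    (g := fun i => 1 + hS.1.eigenvalues i) (fun _ _ => zero_le_one)
    (fun i _ => by linarith [hS.eigenvalues_nonneg i])
  simpa using hp

theorem aux_det_real {n : ℕ} {A : Matrix (Fin n) (Fin n) ℂ} (hA : A.PosDef) :
    0 < A.det.re ∧ A.det = (A.det.re : ℂ) := by
  have h := Complex.pos_iff.mp hA.det_pos
  exact ⟨h.1, Complex.ext (by simp) (by simp [← h.2])⟩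

theorem aux_det_add {n : ℕ} {A : Matrix (Fin n) (Fin n) ℂ} (hA : A.PosDef)
    (X : Matrix (Fin n) (Fin n) ℂ) :
    (A + Xᴴ * X).det.re = A.det.re * (1 + X * A⁻¹ * Xᴴ).det.re := by
  rw [det_add_mul _ _ ((isUnit_iff_isUnit_det A).mp hA.isUnit), (aux_det_real hA).2,
    Complex.re_ofReal_mul, Complex.ofReal_re]

theorem aux_mono {n : ℕ} {A B : Matrix (Fin n) (Fin n) ℂ} (hA : A.PosDef) (hB : B.PosSemidef) :
    A.det.re ≤ (A + B).det.re := by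
  obtain ⟨X, rfl⟩ := aux_psd_fac hB
  rw [aux_det_add hA]
  have := aux_one_le (hA.inv.posSemidef.mul_mul_conjTranspose_same X)
  nlinarith [(aux_det_real hA).1]

theorem aux_inv {n : ℕ} {A B : Matrix (Fin n) (Fin n) ℂ} (hA : A.PosDef) (hB : B.PosSemidef) :
    (A⁻¹ - (A + B)⁻¹).PosSemidef := by
  have hAB := hA.add_posSemidef hB
  letI := hAB.isUnit.invertible
  letI := hA.inv.isUnit.invertible
  have h1 := (PosDef.fromBlocks₁₁ (1 : Matrix (Fin n) (Fin n) ℂ) (A + B) hA.inv).mpr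
    (by simpa [nonsing_inv_nonsing_inv A ((isUnit_iff_isUnit_det A).mp hA.isUnit)] using hB)
  have h2 := (PosDef.fromBlocks₂₂ A⁻¹ (1 : Matrix (Fin n) (Fin n) ℂ) hAB).mp h1
  simpa using h2

theorem aux_submod {n : ℕ} {A B C : Matrix (Fin n) (Fin n) ℂ} (hA : A.PosDef)
    (hB : B.PosSemidef) (hC : C.PosSemidef) :
    Real.log (A + B + C).det.re - Real.log (A + B).det.re ≤
      Real.log (A + C).det.re - Real.log A.det.re := by
  have hAB := hA.add_posSemidef hB
  obtain ⟨X, rfl⟩ := aux_psd_fac hC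
  have p1 := hA.inv.posSemidef.mul_mul_conjTranspose_same X
  have p2 := hAB.inv.posSemidef.mul_mul_conjTranspose_same X
  have p3 := (aux_inv hA hB).mul_mul_conjTranspose_same X
  have o1 := aux_one_le p1
  have o2 := aux_one_le p2
  rw [aux_det_add hA, aux_det_add hAB, Real.log_mul (aux_det_real hA).1.ne' (by linarith),
    Real.log_mul (aux_det_real hAB).1.ne' (by linarith)]
  have : (1 + X * (A + B)⁻¹ * Xᴴ).det.re ≤ (1 + X * A⁻¹ * Xᴴ).det.re := by
    have := aux_mono (PosDef.one.add_posSemidef p2) p3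
    convert this using 3
    noncomm_ring
  have := Real.log_le_log (by linarith) this
  linarith

theorem aux_min {a b a' b' : ℝ} (h : b' - a' ≤ b - a) (h1 : a ≤ b) (h2 : a ≤ a') (h3 : a' ≤ b') :
    min b' 1 - min a' 1 ≤ min b 1 - min a 1 := by
  rcases le_total a 1 with q1 | q1 <;> rcases le_total b 1 with q2 | q2 <;>
  rcases le_total a' 1 with q3 | q3 <;> rcases le_total b' 1 with q4 | q4 <;>
  simp only [min_eq_left, min_eq_right, q1, q2, q3, q4] <;> linarith

theorem aux_split {ι : Type*} [DecidableEq ι] {L n : ℕ} (M : Fin L → ι → Matrix (Fin n) (Fin n) ℂ)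
    (hM : ∀ (ℓ : Fin L) (e : ι), (M ℓ e).PosSemidef) (ℓ : Fin L)
    {U U' : Finset (ι × Fin L)} (h : U ⊆ U') :
    ∃ B : Matrix (Fin n) (Fin n) ℂ, B.PosSemidef ∧
      (1 + ∑ p ∈ U'.filter (fun p => p.2 = ℓ), M ℓ p.1) =
      (1 + ∑ p ∈ U.filter (fun p => p.2 = ℓ), M ℓ p.1) + B := by
  refine ⟨∑ p ∈ (U'.filter (fun p => p.2 = ℓ)) \ (U.filter (fun p => p.2 = ℓ)), M ℓ p.1,
    posSemidef_sum _ fun p _ => hM _ _, ?_⟩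
  rw [add_assoc, add_comm (∑ p ∈ U.filter (fun p => p.2 = ℓ), M ℓ p.1),
    Finset.sum_sdiff (Finset.filter_subset_filter _ h)]

theorem aux_posDef {ι : Type*} {L n : ℕ} (M : Fin L → ι → Matrix (Fin n) (Fin n) ℂ)
    (hM : ∀ (ℓ : Fin L) (e : ι), (M ℓ e).PosSemidef) (ℓ : Fin L) (U : Finset (ι × Fin L)) :
    ((1 : Matrix (Fin n) (Fin n) ℂ) + ∑ p ∈ U.filter (fun p => p.2 = ℓ), M ℓ p.1).PosDef :=
  PosDef.one.add_posSemidef (posSemidef_sum _ fun p _ => hM _ _)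

theorem aux_g_mono {ι : Type*} [DecidableEq ι] {L n : ℕ}
    (M : Fin L → ι → Matrix (Fin n) (Fin n) ℂ)
    (hM : ∀ (ℓ : Fin L) (e : ι), (M ℓ e).PosSemidef)
    {U U' : Finset (ι × Fin L)} (h : U ⊆ U') :
    ∑ ℓ : Fin L, Real.log (((1 : Matrix (Fin n) (Fin n) ℂ)
          + ∑ p ∈ U.filter (fun p => p.2 = ℓ), M ℓ p.1).det.re) ≤
    ∑ ℓ : Fin L, Real.log (((1 : Matrix (Fin n) (Fin n) ℂ)
          + ∑ p ∈ U'.filter (fun p => p.2 = ℓ), M ℓ p.1).det.re) := by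
  refine Finset.sum_le_sum fun ℓ _ => ?_
  obtain ⟨B, hB, e⟩ := aux_split M hM ℓ h
  have hA := aux_posDef M hM ℓ U
  rw [e]
  exact Real.log_le_log (aux_det_real hA).1 (aux_mono hA hB)

theorem aux_g_sub {ι : Type*} [DecidableEq ι] {L n : ℕ}
    (M : Fin L → ι → Matrix (Fin n) (Fin n) ℂ)
    (hM : ∀ (ℓ : Fin L) (e : ι), (M ℓ e).PosSemidef)
    {U U' : Finset (ι × Fin L)} (h : U ⊆ U') (e : ι × Fin L) (he : e ∉ U') :
    ∑ ℓ : Fin L, Real.log (((1 : Matrix (Fin n) (Fin n) ℂ)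
          + ∑ p ∈ (insert e U').filter (fun p => p.2 = ℓ), M ℓ p.1).det.re) -
    ∑ ℓ : Fin L, Real.log (((1 : Matrix (Fin n) (Fin n) ℂ)
          + ∑ p ∈ U'.filter (fun p => p.2 = ℓ), M ℓ p.1).det.re) ≤
    ∑ ℓ : Fin L, Real.log (((1 : Matrix (Fin n) (Fin n) ℂ)
          + ∑ p ∈ (insert e U).filter (fun p => p.2 = ℓ), M ℓ p.1).det.re) -
    ∑ ℓ : Fin L, Real.log (((1 : Matrix (Fin n) (Fin n) ℂ)
          + ∑ p ∈ U.filter (fun p => p.2 = ℓ), M ℓ p.1).det.re) := by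
  rw [← Finset.sum_sub_distrib, ← Finset.sum_sub_distrib]
  refine Finset.sum_le_sum fun ℓ _ => ?_
  by_cases hl : e.2 = ℓ
  · obtain ⟨B, hB, eq⟩ := aux_split M hM ℓ h
    have hA := aux_posDef M hM ℓ U
    have key : ∀ W : Finset (ι × Fin L), e ∉ W →
        (1 : Matrix (Fin n) (Fin n) ℂ) + ∑ p ∈ (insert e W).filter (fun p => p.2 = ℓ), M ℓ p.1 =
        (1 + ∑ p ∈ W.filter (fun p => p.2 = ℓ), M ℓ p.1) + M ℓ e.1 := by
      intro W hW
      rw [Finset.filter_insert, if_pos hl, Finset.sum_insert (by simp [hW])]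
      abel
    rw [key U' he, key U (fun hh => he (h hh)), eq]
    exact aux_submod hA hB (hM _ _)
  · simp only [Finset.filter_insert, if_neg hl, sub_self, le_refl]

/-- The objective of the discrete weighted-sum-delay subproblem,
f(V) := Σ_{k∈I} μ_k · min( c_k · Σ_ℓ log((det(I_n + Σ_{e : (e,ℓ)∈V} M_{k,ℓ,e})).re), 1 ),
with μ_k ≥ 0, c_k > 0 and each M_{k,ℓ,e} Hermitian positive semidefinite, is a monotone
submodular set function on the ground set ι × Fin L. -/
theorem delay_objective_submodular {ι κ : Type*} [DecidableEq ι] {L n : ℕ}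
    (I : Finset κ) (μ c : κ → ℝ) (hμ : ∀ k ∈ I, 0 ≤ μ k) (hc : ∀ k ∈ I, 0 < c k)
    (M : κ → Fin L → ι → Matrix (Fin n) (Fin n) ℂ)
    (hM : ∀ k ∈ I, ∀ (ℓ : Fin L) (e : ι), (M k ℓ e).PosSemidef) :
    Submodular (fun V : Finset (ι × Fin L) =>
      ∑ k ∈ I, μ k * min (c k * ∑ ℓ : Fin L,
        Real.log (((1 : Matrix (Fin n) (Fin n) ℂ)
          + ∑ p ∈ V.filter (fun p => p.2 = ℓ), M k ℓ p.1).det.re)) 1) ∧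
    MonotoneSetFn (fun V : Finset (ι × Fin L) =>
      ∑ k ∈ I, μ k * min (c k * ∑ ℓ : Fin L,
        Real.log (((1 : Matrix (Fin n) (Fin n) ℂ)
          + ∑ p ∈ V.filter (fun p => p.2 = ℓ), M k ℓ p.1).det.re)) 1) := by
  constructor
  · intro U U' h e he
    simp only [ge_iff_le]
    rw [← Finset.sum_sub_distrib, ← Finset.sum_sub_distrib]
    refine Finset.sum_le_sum fun k hk => ?_
    rw [← mul_sub, ← mul_sub]
    refine mul_le_mul_of_nonneg_left ?_ (hμ k hk)
    have hck := (hc k hk).le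
    refine aux_min ?_ ?_ ?_ ?_
    · rw [← mul_sub, ← mul_sub]
      exact mul_le_mul_of_nonneg_left (aux_g_sub (M k) (hM k hk) h e he) hck
    · exact mul_le_mul_of_nonneg_left
        (aux_g_mono (M k) (hM k hk) (Finset.subset_insert _ _)) hck
    · exact mul_le_mul_of_nonneg_left (aux_g_mono (M k) (hM k hk) h) hck
    · exact mul_le_mul_of_nonneg_left
        (aux_g_mono (M k) (hM k hk) (Finset.subset_insert _ _)) hck
  · intro U U' h
    refine Finset.sum_le_sum fun k hk => ?_
    refine mul_le_mul_of_nonneg_left ?_ (hμ k hk)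
    exact min_le_min_right _
      (mul_le_mul_of_nonneg_left (aux_g_mono (M k) (hM k hk) h) (hc k hk).le)
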